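/- arXiv:2005.08779 — 2 statements merged into one kernel-verified Lean document; each statement's English description precedes it below -/
import Mathlib

section
/- Let P_• = (P_i, f_i : P_i → P_{i−1})_{i∈ℤ} be a minimal complex of projective left A-modules such that H_i(P_•) = 0 for all i ≠ 0, −1 and such that the A-dual complex P_•* is acyclic. Set M = Cok f₁. Then M is reduced, both M and M* are semi-Gorenstein-projective, M* ≅ Cok(f₋₁* : P₋₁* → P₋₂*), and M** ≅ Ker f₋₁. -/
/-!
Common background: `A` is an artin algebra (an algebra over a commutative artinian
ring `k`, finitely generated as `k`-module).  Left `A`-modules are `Module A M`;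
right `A`-modules are `Module Aᵐᵒᵖ N`.  `Dl A M = Hom_A(M,A)` is the `A`-dual of a
left module (a right module) and `Dr A N` the dual of a right module (a left module);
`evalL A M : M → M**` is the canonical evaluation map `φ_M`.
-/

open CategoryTheory LinearMap

universe u

section Preliminaries

variable (A : Type u) [Ring A]

/-- The `A`-dual of a left `A`-module: `M* = Hom_A(M, A)`, a right `A`-module. -/
abbrev Dl (M : Type u) [AddCommGroup M] [Module A M] : Type u := M →ₗ[A] A

/-- The `A`-dual of a right `A`-module: a left `A`-module. -/
abbrev Dr (N : Type u) [AddCommGroup N] [Module Aᵐᵒᵖ N] : Type u := N →ₗ[Aᵐᵒᵖ] A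

variable {A}

/-- The dual of a map of left modules. -/
def dualMapL {M N : Type u} [AddCommGroup M] [Module A M] [AddCommGroup N] [Module A N]
    (g : M →ₗ[A] N) : Dl A N →ₗ[Aᵐᵒᵖ] Dl A M where
  toFun h := h.comp g
  map_add' h₁ h₂ := by ext; simp
  map_smul' a h := by ext; simp

/-- The dual of a map of right modules. -/
def dualMapR {M N : Type u} [AddCommGroup M] [Module Aᵐᵒᵖ M] [AddCommGroup N] [Module Aᵐᵒᵖ N]
    (g : M →ₗ[Aᵐᵒᵖ] N) : Dr A N →ₗ[A] Dr A M where
  toFun h := h.comp g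
  map_add' h₁ h₂ := by ext; simp
  map_smul' a h := by ext; simp

variable (A)

/-- The canonical evaluation map `φ_M : M → M**` for a left module `M`. -/
def evalL (M : Type u) [AddCommGroup M] [Module A M] : M →ₗ[A] Dr A (Dl A M) where
  toFun m :=
    { toFun := fun f => f m
      map_add' := fun f g => rfl
      map_smul' := fun a f => rfl }
  map_add' m m' := by ext f; simp
  map_smul' a m := by ext f; simp

/-- The canonical evaluation map `φ_N : N → N**` for a right module `N`. -/
def evalR (N : Type u) [AddCommGroup N] [Module Aᵐᵒᵖ N] : N →ₗ[Aᵐᵒᵖ] Dl A (Dr A N) where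
  toFun n :=
    { toFun := fun f => f n
      map_add' := fun f g => rfl
      map_smul' := fun a f => rfl }
  map_add' n n' := by ext f; simp
  map_smul' a n := by ext f; simp

/-- The radical of a module: the intersection of all maximal submodules. -/
def radM (M : Type u) [AddCommGroup M] [Module A M] : Submodule A M :=
  sInf {N : Submodule A M | IsCoatom N}

/-- A module is *reduced* if it has no nonzero projective direct summand. -/
def Reduced (M : Type u) [AddCommGroup M] [Module A M] : Prop :=
  ∀ N N' : Submodule A M, IsCompl N N' → Module.Projective A N → N = ⊥

/-- Vanishing of `Ext^i_A(M, N)`. -/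
def extZero (M N : Type u) [AddCommGroup M] [Module A M] [AddCommGroup N] [Module A N]
    (i : ℕ) : Prop :=
  Limits.IsZero (((Ext ℤ (ModuleCat.{u} A) i).obj (Opposite.op (ModuleCat.of A M))).obj
    (ModuleCat.of A N))

/-- A left module `M` is semi-Gorenstein-projective if `Ext^i_A(M, A) = 0` for all `i ≥ 1`. -/
def sGp (M : Type u) [AddCommGroup M] [Module A M] : Prop :=
  ∀ i : ℕ, 1 ≤ i → extZero A M A i

/-- Semi-Gorenstein-projectivity for right modules, with `A` as right regular module. -/
def sGpR (N : Type u) [AddCommGroup N] [Module Aᵐᵒᵖ N] : Prop :=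
  ∀ i : ℕ, 1 ≤ i → extZero Aᵐᵒᵖ N A i

/-- `e : P → M` is a projective cover: `P` is a finitely generated projective module,
`e` is surjective and `ker e ⊆ rad P`. -/
def IsProjCover {P M : Type u} [AddCommGroup P] [Module A P] [AddCommGroup M] [Module A M]
    (e : P →ₗ[A] M) : Prop :=
  Module.Projective A P ∧ Module.Finite A P ∧ Function.Surjective e ∧ ker e ≤ radM A P

/-- `P₁ →f P₀ →e M → 0` is a minimal projective presentation of `M`. -/
def IsMinPres {P₁ P₀ M : Type u} [AddCommGroup P₁] [Module A P₁] [AddCommGroup P₀] [Module A P₀]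
    [AddCommGroup M] [Module A M] (f : P₁ →ₗ[A] P₀) (e : P₀ →ₗ[A] M) : Prop :=
  IsProjCover A e ∧ range f = ker e ∧ Module.Projective A P₁ ∧ Module.Finite A P₁ ∧
    ker f ≤ radM A P₁

/-- A minimal projective resolution `⋯ → P₁ → P₀ → M → 0` (ℕ-indexed). -/
def IsMinProjRes (P : ℕ → Type u) [∀ n, AddCommGroup (P n)] [∀ n, Module A (P n)]
    {M : Type u} [AddCommGroup M] [Module A M]
    (f : ∀ n, P (n+1) →ₗ[A] P n) (e : P 0 →ₗ[A] M) : Prop :=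
  (∀ n, Module.Projective A (P n)) ∧ (∀ n, Module.Finite A (P n)) ∧
    Function.Surjective e ∧ range (f 0) = ker e ∧ (∀ n, range (f (n+1)) = ker (f n)) ∧
    ker e ≤ radM A (P 0) ∧ (∀ n, ker (f n) ≤ radM A (P (n+1)))

section ZComplex

variable (P : ℤ → Type u) [∀ i, AddCommGroup (P i)] [∀ i, Module A (P i)]
  (g : ∀ i : ℤ, P i →ₗ[A] P (i-1))

/-- `(P_i, g_i : P_i → P_{i-1})` is a complex. -/
def IsComplexZ : Prop := ∀ i : ℤ, (g (i-1)).comp (g i) = 0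

/-- A complex is minimal if each image lies in the radical. -/
def IsMinimalZ : Prop := ∀ i : ℤ, range (g i) ≤ radM A (P (i-1))

/-- A complex of (finitely generated) projective modules. -/
def IsProjComplexZ : Prop := ∀ i : ℤ, Module.Projective A (P i) ∧ Module.Finite A (P i)

/-- Exactness at position `i - 1`, i.e. `H_{i-1}(P_•) = 0`. -/
def ExactAtPred (i : ℤ) : Prop := range (g i) = ker (g (i-1))

/-- Acyclicity of the `A`-dual complex `P_•^*`. -/
def DualAcyclicZ : Prop :=
  ∀ i : ℤ, range (dualMapL (g (i-1))) = ker (dualMapL (g i))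

/-- The homology of the complex at position `i - 1`. -/
abbrev HomologyAtPred (i : ℤ) : Type u :=
  ↥(ker (g (i-1))) ⧸ (Submodule.comap (ker (g (i-1))).subtype (range (g i)))

end ZComplex

/-- `Z` is (a representative of) the transpose `Tr M` of the left module `M`. -/
def IsTrL (M : Type u) [AddCommGroup M] [Module A M]
    (Z : Type u) [AddCommGroup Z] [Module Aᵐᵒᵖ Z] : Prop :=
  ∃ (P₁ P₀ : ModuleCat.{u} A) (f : P₁ →ₗ[A] P₀) (e : P₀ →ₗ[A] M),
    IsMinPres A f e ∧ Nonempty (Z ≃ₗ[Aᵐᵒᵖ] (Dl A P₁ ⧸ range (dualMapL f)))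

/-- `M` is (a representative of) the transpose `Tr Z` of the right module `Z`. -/
def IsTrR (Z : Type u) [AddCommGroup Z] [Module Aᵐᵒᵖ Z]
    (M : Type u) [AddCommGroup M] [Module A M] : Prop :=
  ∃ (Q₁ Q₀ : ModuleCat.{u} Aᵐᵒᵖ) (d : Q₁ →ₗ[Aᵐᵒᵖ] Q₀) (c : Q₀ →ₗ[Aᵐᵒᵖ] Z),
    IsMinPres Aᵐᵒᵖ d c ∧ Nonempty (M ≃ₗ[A] (Dr A Q₁ ⧸ range (dualMapR d)))

/-- `W` is (a representative of) the syzygy `Ω M` of the left module `M`. -/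
def IsSyzL (W M : Type u) [AddCommGroup W] [Module A W] [AddCommGroup M] [Module A M] : Prop :=
  ∃ (P : ModuleCat.{u} A) (e : P →ₗ[A] M),
    IsProjCover A e ∧ Nonempty (W ≃ₗ[A] ker e)

/-- `W` is (a representative of) the syzygy `Ω Z` of the right module `Z`. -/
def IsSyzR (W Z : Type u) [AddCommGroup W] [Module Aᵐᵒᵖ W] [AddCommGroup Z] [Module Aᵐᵒᵖ Z] :
    Prop :=
  ∃ (Q : ModuleCat.{u} Aᵐᵒᵖ) (c : Q →ₗ[Aᵐᵒᵖ] Z),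
    IsProjCover Aᵐᵒᵖ c ∧ Nonempty (W ≃ₗ[Aᵐᵒᵖ] ker c)

/-- `W` is a second syzygy `Ω² M`. -/
def IsSyz2L (W M : Type u) [AddCommGroup W] [Module A W] [AddCommGroup M] [Module A M] : Prop :=
  ∃ (V : ModuleCat.{u} A), IsSyzL A V M ∧ IsSyzL A W V

/-- `W` is a second syzygy `Ω² Z` of a right module. -/
def IsSyz2R (W Z : Type u) [AddCommGroup W] [Module Aᵐᵒᵖ W] [AddCommGroup Z] [Module Aᵐᵒᵖ Z] :
    Prop :=
  ∃ (V : ModuleCat.{u} Aᵐᵒᵖ), IsSyzR A V Z ∧ IsSyzR A W V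

/-- A right module `Z` is ∞-torsionfree if its transpose is semi-Gorenstein-projective. -/
def InfTfR (Z : Type u) [AddCommGroup Z] [Module Aᵐᵒᵖ Z] : Prop :=
  ∃ (M : ModuleCat.{u} A), IsTrR A Z M ∧ sGp A M

/-- A left module `M` is ∞-torsionfree if its transpose is semi-Gorenstein-projective. -/
def InfTfL (M : Type u) [AddCommGroup M] [Module A M] : Prop :=
  ∃ (Z : ModuleCat.{u} Aᵐᵒᵖ), IsTrL A M Z ∧ sGpR A Z

/-- Projective dimension at most `n` (for objects of `ModuleCat A`). -/
def projDimLEcat : ℕ → ModuleCat.{u} A → Prop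
  | 0, M => Module.Projective A M
  | (n+1), M => ∃ (P : ModuleCat.{u} A) (e : P →ₗ[A] M),
      Module.Projective A P ∧ Module.Finite A P ∧ Function.Surjective e ∧
        projDimLEcat n (ModuleCat.of A (ker e))

/-- Projective dimension at most `n`. -/
def projDimLE (M : Type u) [AddCommGroup M] [Module A M] (n : ℕ) : Prop :=
  projDimLEcat A n (ModuleCat.of A M)

/-- A Nunke module: a semi-Gorenstein-projective module `M` with `M* = 0`. -/
def NunkeL (M : Type u) [AddCommGroup M] [Module A M] : Prop :=
  sGp A M ∧ ∀ f : Dl A M, f = 0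

end Preliminaries

section ExtVanishing

/-- A chain complex of projectives which is exact in positive degrees, together with a cokernel
of its last differential, is a projective resolution. -/
noncomputable def projResOfExactAt {C : Type*} [Category* C] [Abelian C] (K : ChainComplex C ℕ)
    (hK : ∀ n, Projective (K.X n)) {Z : C} (φ : K.X 0 ⟶ Z) (hφ : K.d 1 0 ≫ φ = 0)
    (hex : (ShortComplex.mk _ _ hφ).Exact) (hepi : Epi φ) (hsucc : ∀ n, K.ExactAt (n + 1)) :
    ProjectiveResolution Z where
  complex := K
  projective := hK
  π := (ChainComplex.toSingle₀Equiv _ _).symm ⟨φ, hφ⟩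
  quasiIso := ⟨fun n => by
    cases n with
    | zero =>
      rw [ChainComplex.quasiIsoAt₀_iff, ShortComplex.quasiIso_iff_of_zeros' _
        (K.shape 0 0 (by simp)) rfl rfl]
      have hf := ChainComplex.toSingle₀Equiv_symm_apply_f_zero φ hφ
      constructor
      · convert! hex
      · convert! hepi
    | succ n =>
      rw [quasiIsoAt_iff_exactAt' _ _ (ChainComplex.exactAt_succ_single_obj _ _)]
      exact hsucc n⟩

variable {R : Type u} [Ring R] (Q : ℕ → Type u) [∀ n, AddCommGroup (Q n)] [∀ n, Module R (Q n)]
  (d : ∀ n, Q (n + 1) →ₗ[R] Q n) {M : Type u} [AddCommGroup M] [Module R M] (e : Q 0 →ₗ[R] M)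

/-- The chain complex attached to an exact sequence of modules. -/
noncomputable def chainOfExact (hd : ∀ n, range (d (n + 1)) = ker (d n)) :
    ChainComplex (ModuleCat.{u} R) ℕ :=
  ChainComplex.of (fun n => ModuleCat.of R (Q n)) (fun n => ModuleCat.ofHom (d n)) fun n => by
    rw [← ModuleCat.ofHom_comp, LinearMap.range_le_ker_iff.1 (hd n).le]
    rfl

lemma chainOfExact_d (hd : ∀ n, range (d (n + 1)) = ker (d n)) (n : ℕ) :
    (chainOfExact Q d hd).d (n + 1) n = ModuleCat.ofHom (d n) :=
  ChainComplex.of_d (fun n => ModuleCat.of R (Q n)) (fun n => ModuleCat.ofHom (d n)) n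

/-- An exact sequence of projective modules ending in `M` is a projective resolution of `M`. -/
noncomputable def projResOfExact (hproj : ∀ n, Module.Projective R (Q n))
    (hd : ∀ n, range (d (n + 1)) = ker (d n)) (hde : range (d 0) = ker e)
    (he : Function.Surjective e) : ProjectiveResolution (ModuleCat.of R M) :=
  projResOfExactAt (chainOfExact Q d hd)
    (fun n => (IsProjective.iff_projective (Q n)).1 (hproj n)) (ModuleCat.ofHom e)
    (by
      rw [chainOfExact_d]
      refine (ModuleCat.ofHom_comp _ _).symm.trans ?_
      rw [LinearMap.range_le_ker_iff.1 hde.le]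
      rfl)
    (by
      rw [ShortComplex.moduleCat_exact_iff_range_eq_ker]
      change range ((chainOfExact Q d hd).d 1 0).hom = ker e
      rw [chainOfExact_d]
      exact hde)
    ((ModuleCat.epi_iff_surjective _).2 he)
    (fun n => by
      rw [HomologicalComplex.exactAt_iff' _ (n + 1 + 1) (n + 1) n (by simp) (by simp),
        ShortComplex.moduleCat_exact_iff_range_eq_ker]
      change range ((chainOfExact Q d hd).d _ _).hom = ker ((chainOfExact Q d hd).d _ _).hom
      rw [chainOfExact_d, chainOfExact_d]
      exact hd n)

/-- `Ext^i(M, B)` vanishes for `i ≥ 1` if `Hom(-, B)` is exact in positive degrees on some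
projective resolution of `M`. -/
theorem extZero_of_exact (hproj : ∀ n, Module.Projective R (Q n))
    (hd : ∀ n, range (d (n + 1)) = ker (d n)) (hde : range (d 0) = ker e)
    (he : Function.Surjective e) (B : Type u) [AddCommGroup B] [Module R B]
    (hB : ∀ n, ∀ h : Q (n + 1) →ₗ[R] B, h.comp (d (n + 1)) = 0 →
      ∃ h' : Q n →ₗ[R] B, h'.comp (d n) = h) (i : ℕ) (hi : 1 ≤ i) : extZero R M B i := by
  obtain ⟨n, rfl⟩ := Nat.exists_eq_add_of_le' hi
  refine Limits.IsZero.of_iso ?_ ((projResOfExact Q d e hproj hd hde he).isoExt (n + 1) _)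
  rw [← HomologicalComplex.exactAt_iff_isZero_homology,
    HomologicalComplex.exactAt_iff' _ n (n + 1) (n + 1 + 1) (by simp) (by simp),
    ShortComplex.moduleCat_exact_iff]
  intro (x : (chainOfExact Q d hd).X (n + 1) ⟶ ModuleCat.of R B) hx
  replace hx : (chainOfExact Q d hd).d (n + 1 + 1) (n + 1) ≫ x = 0 := hx
  rw [chainOfExact_d] at hx
  obtain ⟨h', hh'⟩ := hB n x.hom (congrArg ModuleCat.Hom.hom hx)
  refine ⟨(ModuleCat.ofHom h' : ModuleCat.of R (Q n) ⟶ _), ?_⟩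
  change (chainOfExact Q d hd).d (n + 1) n ≫ ModuleCat.ofHom h' = x
  rw [chainOfExact_d]
  exact ModuleCat.hom_ext hh'

end ExtVanishing

section Duality

variable {A : Type u} [Ring A]

@[simp]
lemma dualMapL_apply {M N : Type u} [AddCommGroup M] [Module A M] [AddCommGroup N] [Module A N]
    (g : M →ₗ[A] N) (h : Dl A N) (x : M) : dualMapL g h x = h (g x) := rfl

@[simp]
lemma evalL_apply {M : Type u} [AddCommGroup M] [Module A M] (x : M) (f : Dl A M) :
    evalL A M x f = f x := rfl

/-- A finitely generated projective module has a finite dual basis. -/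
lemma exists_dual_basis (M : Type u) [AddCommGroup M] [Module A M] [Module.Projective A M]
    [Module.Finite A M] :
    ∃ (n : ℕ) (x : Fin n → M) (σ : Fin n → Dl A M), ∀ m, ∑ j, σ j m • x j = m := by
  obtain ⟨n, f, s, -, -, hfs⟩ := Module.Finite.exists_comp_eq_id_of_projective A M
  refine ⟨n, fun j => f (Pi.single j 1), fun j => (LinearMap.proj j).comp s, fun m => ?_⟩
  conv_rhs => rw [← LinearMap.id_apply (R := A) m, ← hfs, LinearMap.comp_apply,
    pi_eq_sum_univ' (s m), map_sum]
  simp [← map_smul, ← Pi.single_smul']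

lemma sum_smul_dual_basis {M : Type u} [AddCommGroup M] [Module A M] {n : ℕ} {x : Fin n → M}
    {σ : Fin n → Dl A M} (h : ∀ m, ∑ j, σ j m • x j = m) (f : Dl A M) :
    ∑ j, MulOpposite.op (f (x j)) • σ j = f := by
  ext m
  conv_rhs => rw [← h m, map_sum]
  simp

/-- A ring is free of rank one as a right module over itself. -/
instance free_mulOpposite_self : Module.Free Aᵐᵒᵖ A :=
  let e : Aᵐᵒᵖ ≃ₗ[Aᵐᵒᵖ] A :=
    { toFun := MulOpposite.unop
      invFun := MulOpposite.op
      map_add' := fun _ _ => rfl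
      map_smul' := fun _ _ => rfl }
  Module.Free.of_equiv e

instance projective_dual (M : Type u) [AddCommGroup M] [Module A M] [Module.Projective A M]
    [Module.Finite A M] : Module.Projective Aᵐᵒᵖ (Dl A M) := by
  obtain ⟨n, x, σ, h⟩ := exists_dual_basis (A := A) M
  let i : Dl A M →ₗ[Aᵐᵒᵖ] (Fin n → A) :=
    { toFun := fun f j => f (x j)
      map_add' := fun _ _ => rfl
      map_smul' := fun _ _ => rfl }
  let s : (Fin n → A) →ₗ[Aᵐᵒᵖ] Dl A M :=
    { toFun := fun a => ∑ j, MulOpposite.op (a j) • σ j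
      map_add' := fun a b => by simp [add_smul, Finset.sum_add_distrib]
      map_smul' := fun c a => by
        induction c with | _ c
        simp [Finset.smul_sum, mul_smul] }
  exact Module.Projective.of_split i s (LinearMap.ext fun f => sum_smul_dual_basis h f)

theorem evalL_bijective (M : Type u) [AddCommGroup M] [Module A M] [Module.Projective A M]
    [Module.Finite A M] : Function.Bijective (evalL A M) := by
  obtain ⟨n, x, σ, h⟩ := exists_dual_basis (A := A) M
  refine ⟨(injective_iff_map_eq_zero _).2 fun m hm => ?_, fun F => ⟨∑ j, F (σ j) • x j, ?_⟩⟩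
  · rw [← h m]
    refine Finset.sum_eq_zero fun j _ => ?_
    rw [← evalL_apply m (σ j), hm, LinearMap.zero_apply, zero_smul]
  · ext f
    conv_rhs => rw [← sum_smul_dual_basis h f]
    simp

/-- The dual of a quotient is the kernel of the dual map. -/
lemma range_dualMapL_mkQ {L M : Type u} [AddCommGroup L] [Module A L] [AddCommGroup M] [Module A M]
    (f : L →ₗ[A] M) : range (dualMapL (range f).mkQ) = ker (dualMapL f) := by
  ext h
  constructor
  · rintro ⟨h, rfl⟩
    ext x
    exact (congrArg h (LinearMap.congr_fun (range_mkQ_comp f) x)).trans h.map_zero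
  · intro hh
    have : range f ≤ ker h := by
      rintro _ ⟨x, rfl⟩
      exact LinearMap.congr_fun hh x
    exact ⟨(range f).liftQ h this, (range f).liftQ_mkQ h this⟩

lemma dualMapR_injective {L M : Type u} [AddCommGroup L] [Module Aᵐᵒᵖ L] [AddCommGroup M]
    [Module Aᵐᵒᵖ M] {f : L →ₗ[Aᵐᵒᵖ] M} (hf : Function.Surjective f) :
    Function.Injective (dualMapR f) :=
  fun _ _ h => (LinearMap.cancel_right hf).1 h

lemma exists_dualMapR_eq {L M : Type u} [AddCommGroup L] [Module Aᵐᵒᵖ L] [AddCommGroup M]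
    [Module Aᵐᵒᵖ M] {f : L →ₗ[Aᵐᵒᵖ] M} (hf : Function.Surjective f) (F : Dr A L)
    (hF : ker f ≤ ker F) : ∃ F', dualMapR f F' = F := by
  refine ⟨((ker f).liftQ F hF).comp (f.quotKerEquivOfSurjective hf).symm.toLinearMap, ?_⟩
  ext x
  have : (f.quotKerEquivOfSurjective hf).symm (f x) = (ker f).mkQ x :=
    (LinearEquiv.symm_apply_eq _).2 rfl
  exact congrArg ((ker f).liftQ F hF) this

/-- If every linear form on a finitely generated module takes values in the radical of the ring,
then the module is reduced. -/
theorem reduced_of_dual_le_radical (M : Type u) [AddCommGroup M] [Module A M] [Module.Finite A M]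
    (h : ∀ f : Dl A M, range f ≤ radM A A) : Reduced A M := by
  intro N N' hNN' hN
  let p : M →ₗ[A] N := N.projectionOnto N' hNN'
  have hp : Function.Surjective p := fun x => ⟨x, Submodule.projectionOnto_apply_left hNN' x⟩
  have : Module.Finite A N := Module.Finite.of_surjective p hp
  obtain ⟨n, x, σ, hσ⟩ := exists_dual_basis (A := A) N
  have htop : (⊤ : Submodule A N) ≤ Ring.jacobson A • (⊤ : Submodule A N) := by
    intro m _
    rw [← hσ m]
    refine Submodule.sum_mem _ fun j _ => Submodule.smul_mem_smul ?_ trivial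
    obtain ⟨m, rfl⟩ := hp m
    exact h ((σ j).comp p) ⟨m, rfl⟩
  have hbot := (Module.Finite.fg_top (R := A) (M := N)).eq_bot_of_le_jacobson_smul htop
  exact Submodule.subsingleton_iff_eq_bot.1 ((Submodule.subsingleton_iff A).1
    (subsingleton_of_bot_eq_top hbot.symm))

lemma map_mem_radM {M N : Type u} [AddCommGroup M] [Module A M] [AddCommGroup N] [Module A N]
    (f : M →ₗ[A] N) {x : M} (hx : x ∈ radM A M) : f x ∈ radM A N :=
  Module.le_comap_jacobson f hx

end Duality

section ZIndexed

variable {A : Type u} [Ring A] {P : ℤ → Type u} [∀ i, AddCommGroup (P i)] [∀ i, Module A (P i)]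
  {g : ∀ i : ℤ, P i →ₗ[A] P (i - 1)}

variable (g) in
/-- The differential `P i → P j` of a `ℤ`-indexed sequence, for any index `j` equal to `i - 1`. -/
def stepMap (i j : ℤ) (h : i - 1 = j) : P i →ₗ[A] P j := by
  subst h
  exact g i

lemma stepMap_exact {i j l : ℤ} (hij : i - 1 = j) (hjl : j - 1 = l) (h : ExactAtPred A P g i) :
    range (stepMap g i j hij) = ker (stepMap g j l hjl) := by
  subst hij hjl
  exact h

lemma dualMapL_stepMap_exact {i j l : ℤ} (hij : i - 1 = j) (hjl : j - 1 = l)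
    (h : DualAcyclicZ A P g) :
    range (dualMapL (stepMap g j l hjl)) = ker (dualMapL (stepMap g i j hij)) := by
  subst hij hjl
  exact h i

theorem sGp_coker (hproj : IsProjComplexZ A P) (hdual : DualAcyclicZ A P g)
    (hH : ∀ i, 1 < i → ExactAtPred A P g i) : sGp A (P 0 ⧸ range (g 1)) := by
  refine extZero_of_exact (fun n : ℕ => P n)
    (fun n => stepMap g (n + 1 : ℕ) n (by push_cast; ring))
    (range (g 1)).mkQ ?_ ?_ ?_ (range (g 1)).mkQ_surjective A ?_
  · exact fun n => (hproj _).1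
  · exact fun n => stepMap_exact _ _ (hH _ (by push_cast; lia))
  · exact (Submodule.ker_mkQ _).symm
  · intro n h hh
    have hmem : h ∈ ker (dualMapL (stepMap g (n + 1 + 1 : ℕ) (n + 1 : ℕ) (by push_cast; ring))) :=
      hh
    rwa [← dualMapL_stepMap_exact _ (l := n) (by push_cast; ring) hdual] at hmem


/-- The map from the cokernel of the differential `P 1 → P 0` to `P (-1)`. -/
def cokerMap (hcx : IsComplexZ A P g) : (P 0 ⧸ range (g 1)) →ₗ[A] P (-1) :=
  (range (g 1)).liftQ (g 0) (LinearMap.range_le_ker_iff.2 (hcx 1))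

lemma dualMapL_cokerMap_surjective (hcx : IsComplexZ A P g) (hdual : DualAcyclicZ A P g) :
    Function.Surjective (dualMapL (cokerMap hcx)) := by
  intro h
  have hmem : dualMapL (range (g 1)).mkQ h ∈ ker (dualMapL (g 1)) :=
    (range_dualMapL_mkQ (g 1)).le ⟨h, rfl⟩
  obtain ⟨h', hh'⟩ := (hdual 1).ge hmem
  refine ⟨h', Submodule.linearMap_qext _ ?_⟩
  exact hh'

lemma ker_dualMapL_cokerMap (hcx : IsComplexZ A P g) (hdual : DualAcyclicZ A P g) :
    range (dualMapL (g (-1))) = ker (dualMapL (cokerMap hcx)) := by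
  refine (hdual 0).trans ?_
  ext h
  exact ⟨fun hh => Submodule.linearMap_qext _ hh,
    fun hh => congrArg (dualMapL (range (g 1)).mkQ) hh⟩

theorem sGpR_dual_coker (hcx : IsComplexZ A P g) (hproj : IsProjComplexZ A P)
    (hdual : DualAcyclicZ A P g)
    (hH : ∀ i, i < 0 → ExactAtPred A P g i) : sGpR A (Dl A (P 0 ⧸ range (g 1))) := by
  have hfin : ∀ i, Module.Finite A (P i) := fun i => (hproj i).2
  have hpr : ∀ i, Module.Projective A (P i) := fun i => (hproj i).1
  refine extZero_of_exact (fun n : ℕ => Dl A (P (-1 - n)))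
    (fun n => dualMapL (stepMap g (-1 - n) (-1 - (n + 1 : ℕ)) (by push_cast; ring)))
    (dualMapL (cokerMap hcx)) ?_ ?_ ?_ (dualMapL_cokerMap_surjective hcx hdual) A ?_
  · exact fun n => projective_dual _
  · exact fun n => dualMapL_stepMap_exact _ _ hdual
  · exact ker_dualMapL_cokerMap hcx hdual
  · intro n F hF
    obtain ⟨x, rfl⟩ := (evalL_bijective (A := A) (P (-1 - (n + 1 : ℕ)))).2 F
    have hx : x ∈ ker (stepMap g (-1 - (n + 1 : ℕ)) (-1 - (n + 1 + 1 : ℕ))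
        (by push_cast; ring)) := by
      refine (evalL_bijective (A := A) (P _)).1 ?_
      rw [map_zero]
      exact hF
    rw [← stepMap_exact (i := -1 - n) (by push_cast; ring) _ (hH _ (by lia))] at hx
    obtain ⟨y, rfl⟩ := hx
    exact ⟨evalL A _ y, rfl⟩

/-- The dual of the cokernel of `P 1 → P 0` is the cokernel of the dual of `P (-1) → P (-2)`. -/
noncomputable def dualCokerEquiv (hcx : IsComplexZ A P g) (hdual : DualAcyclicZ A P g) :
    (Dl A (P (-1)) ⧸ range (dualMapL (g (-1)))) ≃ₗ[Aᵐᵒᵖ] Dl A (P 0 ⧸ range (g 1)) :=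
  (Submodule.quotEquivOfEq _ _ (ker_dualMapL_cokerMap hcx hdual)).trans
    ((dualMapL (cokerMap hcx)).quotKerEquivOfSurjective (dualMapL_cokerMap_surjective hcx hdual))

theorem nonempty_bidual_coker_equiv (hcx : IsComplexZ A P g) (hproj : IsProjComplexZ A P)
    (hdual : DualAcyclicZ A P g) :
    Nonempty (Dr A (Dl A (P 0 ⧸ range (g 1))) ≃ₗ[A] ker (g (-1))) := by
  have hfin : ∀ i, Module.Finite A (P i) := fun i => (hproj i).2
  have hpr : ∀ i, Module.Projective A (P i) := fun i => (hproj i).1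
  let ε := LinearEquiv.ofBijective (evalL A (P (-1))) (evalL_bijective _)
  have hsurj := dualMapL_cokerMap_surjective hcx hdual
  have hker := ker_dualMapL_cokerMap hcx hdual
  let θ : Dr A (Dl A (P 0 ⧸ range (g 1))) →ₗ[A] P (-1) :=
    ε.symm.toLinearMap.comp (dualMapR (dualMapL (cokerMap hcx)))
  have hθ : Function.Injective θ := ε.symm.injective.comp (dualMapR_injective hsurj)
  have hrange : range θ = ker (g (-1)) := by
    ext x
    constructor
    · rintro ⟨F, rfl⟩
      refine (evalL_bijective (A := A) (P _)).1 ?_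
      rw [map_zero]
      ext h
      have hF : ε (θ F) = dualMapR (dualMapL (cokerMap hcx)) F := ε.apply_symm_apply _
      have h0 : dualMapL (cokerMap hcx) (dualMapL (g (-1)) h) = 0 := hker.le ⟨h, rfl⟩
      calc ε (θ F) (dualMapL (g (-1)) h) = F (dualMapL (cokerMap hcx) (dualMapL (g (-1)) h)) := by
            rw [hF]; rfl
        _ = 0 := by rw [h0, map_zero]
    · intro hx
      obtain ⟨F, hF⟩ := exists_dualMapR_eq hsurj (evalL A (P (-1)) x) (by
        rw [← hker]
        rintro _ ⟨h, rfl⟩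
        exact (congrArg h hx).trans h.map_zero)
      exact ⟨F, ε.symm_apply_eq.2 hF⟩
  exact ⟨(LinearEquiv.ofInjective θ hθ).trans (LinearEquiv.ofEq _ _ hrange)⟩

theorem reduced_coker (hcx : IsComplexZ A P g) (hmin : IsMinimalZ A P g)
    (hproj : IsProjComplexZ A P) (hdual : DualAcyclicZ A P g) : Reduced A (P 0 ⧸ range (g 1)) := by
  have := (hproj 0).2
  refine reduced_of_dual_le_radical _ fun f => ?_
  obtain ⟨h, rfl⟩ := dualMapL_cokerMap_surjective hcx hdual f
  rintro _ ⟨y, rfl⟩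
  obtain ⟨x, rfl⟩ := (range (g 1)).mkQ_surjective y
  exact map_mem_radM h (hmin 0 ⟨x, rfl⟩)

end ZIndexed


/-- Theorem 2.1 (converse half): if `P_•` is a minimal complex of projective modules with
`H_i(P_•) = 0` for `i ≠ 0, -1` and acyclic `A`-dual complex, then `M = Cok f₁` is reduced,
both `M` and `M^*` are semi-Gorenstein-projective, `M^* ≅ Cok f₋₁^*` and `M^{**} ≅ Ker f₋₁`. -/
theorem minimal_complex_gives_both_sgp (k : Type u) [CommRing k] [IsArtinianRing k]
    (A : Type u) [Ring A] [Algebra k A] [Module.Finite k A]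
    (P : ℤ → Type u) [∀ i, AddCommGroup (P i)] [∀ i, Module A (P i)]
    (g : ∀ i : ℤ, P i →ₗ[A] P (i-1))
    (hcx : IsComplexZ A P g) (hmin : IsMinimalZ A P g) (hproj : IsProjComplexZ A P)
    (hH : ∀ i : ℤ, i ≠ 0 → i ≠ 1 → ExactAtPred A P g i)
    (hdual : DualAcyclicZ A P g) :
    Reduced A (P 0 ⧸ (range (g 1))) ∧
    sGp A (P 0 ⧸ (range (g 1))) ∧
    sGpR A (Dl A (P 0 ⧸ (range (g 1)))) ∧
    Nonempty (((Dl A (P (-1))) ⧸ range (dualMapL (g (-1)))) ≃ₗ[Aᵐᵒᵖ]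
      Dl A (P 0 ⧸ (range (g 1)))) ∧
    Nonempty ((Dr A (Dl A (P 0 ⧸ (range (g 1))))) ≃ₗ[A] ↥(ker (g (-1)))) := by
  exact ⟨reduced_coker hcx hmin hproj hdual,
    sGp_coker hproj hdual fun i hi => hH i (by lia) (by lia),
    sGpR_dual_coker hcx hproj hdual fun i hi => hH i (by lia) (by lia),
    ⟨dualCokerEquiv hcx hdual⟩, nonempty_bidual_coker_equiv hcx hproj hdual⟩
end

section
/- The transpose Tr provides a bijection between the isomorphism classes of reduced left A-modules M such that both M and M* are semi-Gorenstein-projective, and the isomorphism classes of reduced ∞-torsionfree right A-modules Z such that Ω²Z is semi-Gorenstein-projective. Explicitly: if M is a reduced module with M and M* semi-Gorenstein-projective, then Z = Tr M is a reduced ∞-torsionfree right module with Ω²Z ≅ M* semi-Gorenstein-projective; conversely, if Z is a reduced ∞-torsionfree right module with Ω²Z semi-Gorenstein-projective, then M = Tr Z is reduced, M is semi-Gorenstein-projective, and M* ≅ Ω²Z is semi-Gorenstein-projective; and Tr Tr M ≅ M for reduced M. -/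
/-!
Common background: `A` is an artin algebra (an algebra over a commutative artinian
ring `k`, finitely generated as `k`-module).  Left `A`-modules are `Module A M`;
right `A`-modules are `Module Aᵐᵒᵖ N`.  `Dl A M = Hom_A(M,A)` is the `A`-dual of a
left module (a right module) and `Dr A N` the dual of a right module (a left module);
`evalL A M : M → M**` is the canonical evaluation map `φ_M`.
-/

open CategoryTheory LinearMap

universe u

/-- The two classes of Proposition 2.4. -/
def BothSgpClass (A : Type u) [Ring A] (M : Type u) [AddCommGroup M] [Module A M] : Prop :=
  Module.Finite A M ∧ Reduced A M ∧ sGp A M ∧ sGpR A (Dl A M)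

def TfSyz2SgpClass (A : Type u) [Ring A] (Z : Type u) [AddCommGroup Z] [Module Aᵐᵒᵖ Z] : Prop :=
  Module.Finite Aᵐᵒᵖ Z ∧ Reduced Aᵐᵒᵖ Z ∧ InfTfR A Z ∧
    ∀ W : ModuleCat.{u} Aᵐᵒᵖ, IsSyz2R A (↥W) Z → sGpR A (↥W)

section Radical

variable {R : Type u} [Ring R]

theorem isUnit_one_add_mul_of_mem_jacobson [IsArtinianRing R] {x : R}
    (hx : x ∈ Ring.jacobson R) (y : R) : IsUnit (1 + x * y) := by
  have h : IsNilpotent (x * y) := by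
    obtain ⟨n, hn⟩ := IsArtinianRing.isNilpotent_jacobson_bot (R := R)
    refine ⟨n, ?_⟩
    have hxy : x * y ∈ Ideal.jacobson (⊥ : Ideal R) := by
      rw [Ideal.jacobson_bot]
      exact Ideal.mul_mem_right _ _ hx
    have := Ideal.pow_mem_pow hxy n
    rw [hn] at this
    simpa using this
  exact h.isUnit_one_add

theorem mem_jacobson_of_isUnit_one_add_mul {x : R} (h : ∀ y, IsUnit (1 + y * x)) :
    x ∈ Ring.jacobson R := by
  rw [← Ideal.jacobson_bot, Ideal.mem_jacobson_iff]
  intro y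
  obtain ⟨u, hu⟩ := h y
  refine ⟨(u⁻¹ : Rˣ), ?_⟩
  have h₁ : ((u⁻¹ : Rˣ) : R) * (1 + y * x) = 1 := by rw [← hu]; simp
  rw [Ideal.mem_bot, ← h₁]
  noncomm_ring

theorem op_mem_jacobson [IsArtinianRing R] {x : R} (hx : x ∈ Ring.jacobson R) :
    MulOpposite.op x ∈ Ring.jacobson Rᵐᵒᵖ := by
  refine mem_jacobson_of_isUnit_one_add_mul fun y => ?_
  simpa using (isUnit_one_add_mul_of_mem_jacobson hx y.unop).op

theorem unop_mem_jacobson [IsArtinianRing Rᵐᵒᵖ] {x : Rᵐᵒᵖ} (hx : x ∈ Ring.jacobson Rᵐᵒᵖ) :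
    x.unop ∈ Ring.jacobson R := by
  refine mem_jacobson_of_isUnit_one_add_mul fun y => ?_
  simpa using (isUnit_one_add_mul_of_mem_jacobson hx (MulOpposite.op y)).unop

variable {P M : Type u} [AddCommGroup P] [Module R P] [AddCommGroup M] [Module R M]

theorem map_mem_radM_s4 (f : P →ₗ[R] M) {p : P} (hp : p ∈ radM R P) : f p ∈ radM R M :=
  Module.le_comap_jacobson f hp

/-- The radical of a finitely generated module is superfluous. -/
theorem eq_top_of_sup_eq_top [Module.Finite R P] {N K : Submodule R P} (hK : K ≤ radM R P)
    (h : N ⊔ K = ⊤) : N = ⊤ := by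
  obtain h' | ⟨m, hm, hNm⟩ := eq_top_or_exists_le_coatom N
  · exact h'
  · exact absurd (top_le_iff.mp (h ▸ sup_le hNm (hK.trans (sInf_le hm)))) hm.1

theorem surjective_of_comp_surjective [Module.Finite R P] {Q : Type u} [AddCommGroup Q]
    [Module R Q] {e : P →ₗ[R] M} (hK : ker e ≤ radM R P) (g : Q →ₗ[R] P)
    (h : Function.Surjective (e ∘ₗ g)) : Function.Surjective g := by
  rw [← range_eq_top]
  refine eq_top_of_sup_eq_top hK (eq_top_iff.mpr fun p _ => ?_)
  obtain ⟨q, hq⟩ := h (e p)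
  rw [← add_sub_cancel (g q) p]
  exact Submodule.add_mem_sup (mem_range_self g q) (by simpa [sub_eq_zero] using hq.symm)

end Radical

section MinimalPresentations

variable {R : Type u} [Ring R]
variable {P P' M M' : Type u} [AddCommGroup P] [Module R P] [AddCommGroup P'] [Module R P']
  [AddCommGroup M] [Module R M] [AddCommGroup M'] [Module R M']

theorem IsProjCover.exists_equiv {e : P →ₗ[R] M} {e' : P' →ₗ[R] M'} (he : IsProjCover R e)
    (he' : IsProjCover R e') (α : M ≃ₗ[R] M') : ∃ β : P ≃ₗ[R] P', ∀ p, e' (β p) = α (e p) := by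
  obtain ⟨hP, hPf, hes, hek⟩ := he
  obtain ⟨hP', hPf', hes', hek'⟩ := he'
  obtain ⟨β, hβ⟩ := Module.projective_lifting_property e' (α.toLinearMap ∘ₗ e) hes'
  have hβs : Function.Surjective β := surjective_of_comp_surjective hek' β (by
    rw [hβ]; exact α.surjective.comp hes)
  obtain ⟨s, hs⟩ := Module.projective_lifting_property β LinearMap.id hβs
  have hβs' : ∀ x, β (s x) = x := fun x => by simpa using LinearMap.congr_fun hs x
  have hss : Function.Surjective s := surjective_of_comp_surjective hek s (by
    intro m
    obtain ⟨x, hx⟩ := hes' (α m)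
    refine ⟨x, α.injective ?_⟩
    have := LinearMap.congr_fun hβ (s x)
    simp only [LinearMap.comp_apply, hβs'] at this
    rw [← hx, this]; rfl)
  have hβi : Function.Injective β := by
    intro a b hab
    obtain ⟨a, rfl⟩ := hss a
    obtain ⟨b, rfl⟩ := hss b
    rw [hβs', hβs'] at hab
    rw [hab]
  exact ⟨LinearEquiv.ofBijective β ⟨hβi, hβs⟩, fun p => LinearMap.congr_fun hβ p⟩

theorem exists_ker_equiv {e : P →ₗ[R] M} {e' : P' →ₗ[R] M'} {β : P ≃ₗ[R] P'}
    {α : M ≃ₗ[R] M'} (h : ∀ p, e' (β p) = α (e p)) :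
    ∃ γ : ker e ≃ₗ[R] ker e', ∀ x, (γ x : P') = β x := by
  refine ⟨β.submoduleMap (ker e) ≪≫ₗ LinearEquiv.ofEq _ _ ?_, fun x => rfl⟩
  ext y
  obtain ⟨p, rfl⟩ := β.surjective y
  simp [h]

theorem IsSyzL.unique {W W' : Type u} [AddCommGroup W] [Module R W] [AddCommGroup W'] [Module R W']
    (h : IsSyzL R W M) (h' : IsSyzL R W' M') (α : M ≃ₗ[R] M') : Nonempty (W ≃ₗ[R] W') := by
  obtain ⟨P, e, he, ⟨w⟩⟩ := h
  obtain ⟨P', e', he', ⟨w'⟩⟩ := h'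
  obtain ⟨β, hβ⟩ := he.exists_equiv he' α
  obtain ⟨γ, -⟩ := exists_ker_equiv hβ
  exact ⟨w ≪≫ₗ γ ≪≫ₗ w'.symm⟩

theorem IsSyz2L.unique {W W' : Type u} [AddCommGroup W] [Module R W] [AddCommGroup W'] [Module R W']
    (h : IsSyz2L R W M) (h' : IsSyz2L R W' M) : Nonempty (W ≃ₗ[R] W') := by
  obtain ⟨V, hV, hW⟩ := h
  obtain ⟨V', hV', hW'⟩ := h'
  obtain ⟨v⟩ := hV.unique hV' (LinearEquiv.refl R M)
  exact hW.unique hW' v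

variable {P₁ P₁' : Type u} [AddCommGroup P₁] [Module R P₁] [AddCommGroup P₁'] [Module R P₁']

theorem IsMinPres.isProjCover {f : P₁ →ₗ[R] P} {e : P →ₗ[R] M} (h : IsMinPres R f e) :
    IsProjCover R (f.codRestrict (ker e) fun x => h.2.1 ▸ mem_range_self f x) := by
  obtain ⟨-, hr, hP, hf, hk⟩ := h
  refine ⟨hP, hf, ?_, by rwa [ker_codRestrict]⟩
  rintro ⟨y, hy⟩
  rw [← hr] at hy
  obtain ⟨x, rfl⟩ := hy
  exact ⟨x, rfl⟩

theorem IsMinPres.exists_equiv {f : P₁ →ₗ[R] P} {e : P →ₗ[R] M} {f' : P₁' →ₗ[R] P'}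
    {e' : P' →ₗ[R] M'} (h : IsMinPres R f e) (h' : IsMinPres R f' e') (α : M ≃ₗ[R] M') :
    ∃ (β₁ : P₁ ≃ₗ[R] P₁') (β : P ≃ₗ[R] P'), ∀ x, f' (β₁ x) = β (f x) := by
  obtain ⟨β, hβ⟩ := h.1.exists_equiv h'.1 α
  obtain ⟨γ, hγ⟩ := exists_ker_equiv hβ
  obtain ⟨β₁, hβ₁⟩ := h.isProjCover.exists_equiv h'.isProjCover γ
  refine ⟨β₁, β, fun x => ?_⟩
  have := congrArg Subtype.val (hβ₁ x)
  rwa [hγ] at this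

theorem IsMinPres.isSyz2L {f : P₁ →ₗ[R] P} {e : P →ₗ[R] M} (h : IsMinPres R f e) :
    IsSyz2L R (ker f) M := by
  refine ⟨ModuleCat.of R (ker e), ⟨ModuleCat.of R P, e, h.1, ⟨LinearEquiv.refl _ _⟩⟩,
    ModuleCat.of R P₁, _, h.isProjCover, ⟨LinearEquiv.ofEq _ _ ?_⟩⟩
  rw [ker_codRestrict]

theorem extZero_congr {N : Type u} [AddCommGroup N] [Module R N] (α : M ≃ₗ[R] M') {i : ℕ}
    (h : extZero R M N i) : extZero R M' N i :=
  h.of_iso (((Ext ℤ (ModuleCat.{u} R) i).mapIso α.toModuleIso.op).app (ModuleCat.of R N))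

end MinimalPresentations

/-- A bimodule `D` over two rings `R` and `S` that is free of rank one on both sides on a common
generator, and whose two radicals agree. For `R = A`, `S = Aᵐᵒᵖ`, `D = A` the functor
`Hom_R(-, D)` is the `A`-dual of left modules; exchanging `R` and `S` gives the dual of right
modules. -/
structure RegularBimodule (R S D : Type u) [Ring R] [Ring S] [AddCommGroup D] [Module R D]
    [Module S D] where
  left : R ≃ₗ[R] D
  right : S ≃ₗ[S] D
  left_one : left 1 = right 1
  mem_radM_iff : ∀ d : D, d ∈ radM R D ↔ d ∈ radM S D

/-- A ring as a bimodule over itself. -/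
def RegularBimodule.ofRing (A : Type u) [Ring A] [IsArtinianRing A] [IsArtinianRing Aᵐᵒᵖ] :
    RegularBimodule A Aᵐᵒᵖ A where
  left := LinearEquiv.refl A A
  right := (MulOpposite.opLinearEquiv Aᵐᵒᵖ (M := A)).symm
  left_one := rfl
  mem_radM_iff d := by
    let ρ : A ≃ₗ[Aᵐᵒᵖ] Aᵐᵒᵖ := MulOpposite.opLinearEquiv Aᵐᵒᵖ
    constructor
    · intro h
      exact map_mem_radM_s4 ρ.symm.toLinearMap (p := MulOpposite.op d) (op_mem_jacobson h)
    · intro h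
      exact unop_mem_jacobson (x := MulOpposite.op d) (map_mem_radM_s4 ρ.toLinearMap h)

section Bimodule

variable {R S D : Type u} [Ring R] [Ring S] [AddCommGroup D] [Module R D] [Module S D]
  [SMulCommClass R S D]

/-- The same bimodule with the two sides exchanged. -/
def RegularBimodule.symm (B : RegularBimodule R S D) : RegularBimodule S R D where
  left := B.right
  right := B.left
  left_one := B.left_one.symm
  mem_radM_iff d := (B.mem_radM_iff d).symm

variable {M N P : Type u} [AddCommGroup M] [Module R M] [AddCommGroup N] [Module R N]
  [AddCommGroup P] [Module R P]

variable (S D) in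
/-- The map `Hom_R(N, D) → Hom_R(M, D)` induced by `g : M → N`. -/
def dualMapInto (g : M →ₗ[R] N) : (N →ₗ[R] D) →ₗ[S] (M →ₗ[R] D) where
  toFun h := h.comp g
  map_add' h₁ h₂ := by ext; simp
  map_smul' a h := by ext; simp

@[simp]
theorem dualMapInto_apply (g : M →ₗ[R] N) (h : N →ₗ[R] D) (m : M) :
    dualMapInto S D g h m = h (g m) := rfl

variable (S D) in
/-- The isomorphism `Hom_R(N, D) ≃ Hom_R(M, D)` induced by `g : M ≃ N`. -/
def dualEquivInto (g : M ≃ₗ[R] N) : (N →ₗ[R] D) ≃ₗ[S] (M →ₗ[R] D) :=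
  LinearEquiv.ofLinearMap (dualMapInto S D g.toLinearMap) (dualMapInto S D g.symm.toLinearMap)
    (by ext; simp) (by ext; simp)

variable (R S D) in
/-- `Z` is isomorphic to the cokernel of `Hom_R(f, D)` for a minimal projective presentation `f`
of `M`. -/
def IsTranspose (M : Type u) [AddCommGroup M] [Module R M] (Z : Type u) [AddCommGroup Z]
    [Module S Z] : Prop :=
  ∃ (P₁ P₀ : ModuleCat.{u} R) (f : P₁ →ₗ[R] P₀) (e : P₀ →ₗ[R] M),
    IsMinPres R f e ∧ Nonempty (Z ≃ₗ[S] ((P₁ →ₗ[R] D) ⧸ range (dualMapInto S D f)))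

theorem IsTranspose.unique {Z Z' : Type u} [AddCommGroup Z] [Module S Z] [AddCommGroup Z']
    [Module S Z'] (h : IsTranspose R S D M Z) (h' : IsTranspose R S D M Z') :
    Nonempty (Z ≃ₗ[S] Z') := by
  obtain ⟨P₁, P₀, f, e, hf, ⟨z⟩⟩ := h
  obtain ⟨P₁', P₀', f', e', hf', ⟨z'⟩⟩ := h'
  obtain ⟨β₁, β, hβ⟩ := hf'.exists_equiv hf (LinearEquiv.refl R M)
  refine ⟨z ≪≫ₗ Submodule.Quotient.equiv _ _ (dualEquivInto S D β₁) ?_ ≪≫ₗ z'.symm⟩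
  ext g
  simp only [Submodule.mem_map, mem_range]
  constructor
  · rintro ⟨_, ⟨h, rfl⟩, rfl⟩
    refine ⟨h ∘ₗ β.toLinearMap, LinearMap.ext fun x => ?_⟩
    exact congrArg h (hβ x).symm
  · rintro ⟨h, rfl⟩
    refine ⟨_, ⟨h ∘ₗ β.symm.toLinearMap, rfl⟩, LinearMap.ext fun x => ?_⟩
    change h (β.symm (f (β₁ x))) = h (f' x)
    rw [hβ, β.symm_apply_apply]

omit [SMulCommClass R S D] in
theorem exists_comp_eq_of_ker_le {e : P →ₗ[R] M} (hes : Function.Surjective e) {g : P →ₗ[R] D}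
    (h : ker e ≤ ker g) : ∃ g' : M →ₗ[R] D, g' ∘ₗ e = g := by
  refine ⟨(ker e).liftQ g h ∘ₗ (e.quotKerEquivOfSurjective hes).symm.toLinearMap,
    LinearMap.ext fun p => ?_⟩
  have : (e.quotKerEquivOfSurjective hes).symm (e p) = (ker e).mkQ p := by
    rw [LinearEquiv.symm_apply_eq]; rfl
  simp [this]

/-- The dual of a finitely presented module is the kernel of the dual of the presentation. -/
theorem dual_equiv_ker {P₁ P₀ : Type u} [AddCommGroup P₁]
    [Module R P₁] [AddCommGroup P₀] [Module R P₀]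
    {f : P₁ →ₗ[R] P₀} {e : P₀ →ₗ[R] M} (hes : Function.Surjective e)
    (hr : range f = ker e) : Nonempty ((M →ₗ[R] D) ≃ₗ[S] ker (dualMapInto S D f)) := by
  let j : (M →ₗ[R] D) →ₗ[S] ker (dualMapInto S D f) :=
    (dualMapInto S D e).codRestrict _ fun g => by
      refine LinearMap.ext fun x => ?_
      have : e (f x) = 0 := by
        rw [← LinearMap.mem_ker, ← hr]; exact mem_range_self f x
      change g (e (f x)) = 0
      rw [this, map_zero]
  refine ⟨LinearEquiv.ofBijective j ⟨fun g g' h => LinearMap.ext fun m => ?_, ?_⟩⟩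
  · obtain ⟨p, rfl⟩ := hes m
    exact LinearMap.congr_fun (congrArg Subtype.val h) p
  · rintro ⟨g, hg⟩
    have hge : ker e ≤ ker g := by
      rw [← hr]
      rintro _ ⟨x, rfl⟩
      exact LinearMap.congr_fun hg x
    obtain ⟨g', rfl⟩ := exists_comp_eq_of_ker_le hes hge
    exact ⟨g', rfl⟩

namespace RegularBimodule

variable (B : RegularBimodule R S D)
include B

/-- A finite dual basis of a finitely generated projective module, with values in `D`. -/
theorem exists_dualBasis [Module.Finite R P] [Module.Projective R P] :
    ∃ (n : ℕ) (x : Fin n → P) (φ : Fin n → (P →ₗ[R] D)),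
      (∀ p, p = ∑ i, B.left.symm (φ i p) • x i) ∧
      ∀ f : P →ₗ[R] D, f = ∑ i, B.right.symm (f (x i)) • φ i := by
  obtain ⟨n, F, G, -, -, hFG⟩ := Module.Finite.exists_comp_eq_id_of_projective R P
  have hx : ∀ p, p = ∑ i, G p i • F (Pi.single i 1) := fun p => by
    conv_lhs => rw [← LinearMap.id_apply (R := R) p, ← hFG, LinearMap.comp_apply,
      pi_eq_sum_univ' (G p), map_sum]
    exact Finset.sum_congr rfl fun i _ => map_smul _ _ _
  refine ⟨n, fun i => F (Pi.single i 1), fun i => B.left.toLinearMap ∘ₗ LinearMap.proj i ∘ₗ G,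
    fun p => by simpa using hx p, fun f => LinearMap.ext fun p => ?_⟩
  conv_lhs => rw [hx p, map_sum]
  rw [LinearMap.sum_apply]
  refine Finset.sum_congr rfl fun i _ => ?_
  have h₁ : f (F (Pi.single i 1)) = B.right.symm (f (F (Pi.single i 1))) • B.right 1 := by
    rw [← map_smul]; simp
  have h₂ : B.left (G p i) = G p i • B.left 1 := by rw [← map_smul]; simp
  simp only [map_smul, LinearMap.smul_apply, LinearMap.comp_apply, LinearMap.proj_apply,
    LinearEquiv.coe_coe]
  rw [h₂, B.left_one, ← smul_comm (G p i), ← h₁]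

theorem eq_zero_of_forall_apply_eq_zero [Module.Finite R P] [Module.Projective R P] {p : P}
    (h : ∀ f : P →ₗ[R] D, f p = 0) : p = 0 := by
  obtain ⟨n, x, φ, hx, -⟩ := B.exists_dualBasis (P := P)
  rw [hx p]
  simp [h]

theorem exists_eq_eval [Module.Finite R P] [Module.Projective R P] (ψ : (P →ₗ[R] D) →ₗ[S] D) :
    ∃ p, ∀ f, ψ f = f p := by
  obtain ⟨n, x, φ, -, hφ⟩ := B.exists_dualBasis (P := P)
  refine ⟨∑ i, B.left.symm (ψ (φ i)) • x i, fun f => ?_⟩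
  conv_lhs => rw [hφ f, map_sum]
  rw [map_sum]
  refine Finset.sum_congr rfl fun i _ => ?_
  have h₁ : f (x i) = B.right.symm (f (x i)) • B.right 1 := by
    rw [← map_smul]; simp
  have h₂ : ψ (φ i) = B.left.symm (ψ (φ i)) • B.left 1 := by rw [← map_smul]; simp
  rw [map_smul, map_smul]
  conv_lhs => rw [h₂]
  conv_rhs => rw [h₁]
  rw [B.left_one, ← smul_comm (B.left.symm (ψ (φ i)))]

theorem finite_projective_dual [Module.Finite R P] [Module.Projective R P] :
    Module.Finite S (P →ₗ[R] D) ∧ Module.Projective S (P →ₗ[R] D) := by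
  obtain ⟨n, x, φ, -, hφ⟩ := B.exists_dualBasis (P := P)
  let s : (Fin n → S) →ₗ[S] (P →ₗ[R] D) := Fintype.linearCombination S φ
  let i : (P →ₗ[R] D) →ₗ[S] (Fin n → S) := LinearMap.pi fun j =>
    B.right.symm.toLinearMap ∘ₗ
      { toFun := fun f => f (x j), map_add' := fun _ _ => rfl, map_smul' := fun _ _ => rfl }
  have h : s ∘ₗ i = LinearMap.id := LinearMap.ext fun f => by
    conv_rhs => rw [LinearMap.id_apply, hφ f]
    rfl
  exact ⟨Module.Finite.of_surjective s fun f => ⟨i f, LinearMap.congr_fun h f⟩,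
    Module.Projective.of_split i s h⟩

theorem mem_radM_dual [Module.Finite R P] [Module.Projective R P] {g : P →ₗ[R] D}
    (hg : ∀ p, g p ∈ radM R D) : g ∈ radM S (P →ₗ[R] D) := by
  obtain ⟨n, x, φ, -, hφ⟩ := B.exists_dualBasis (P := P)
  rw [hφ g]
  refine Submodule.sum_mem _ fun i _ => ?_
  exact map_mem_radM_s4 (LinearMap.toSpanSingleton S _ (φ i))
    (map_mem_radM_s4 B.right.symm.toLinearMap ((B.mem_radM_iff _).mp (hg (x i))))

theorem reduced_of_forall_mem_radM [Module.Finite R M]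
    (h : ∀ (g : M →ₗ[R] D) (m : M), g m ∈ radM R D) : Reduced R M := by
  intro N N' hN hP
  let π : M →ₗ[R] N := Submodule.projectionOnto N N' hN
  have hπ : Function.Surjective π := Submodule.projectionOnto_surjective hN
  have : Module.Finite R N := Module.Finite.of_surjective π hπ
  obtain ⟨n, x, φ, hx, -⟩ := B.exists_dualBasis (P := N)
  refine Submodule.FG.eq_bot_of_le_jacobson_smul (Module.Finite.iff_fg.mp this) fun y hy => ?_
  obtain ⟨m, hm⟩ := hπ ⟨y, hy⟩
  have hy' : y = ∑ i, B.left.symm (φ i ⟨y, hy⟩) • (x i : M) := by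
    have := congrArg Subtype.val (hx ⟨y, hy⟩)
    simpa using this
  rw [hy']
  refine Submodule.sum_mem _ fun i _ => Submodule.smul_mem_smul ?_ (x i).2
  exact map_mem_radM_s4 B.left.symm.toLinearMap (by rw [← hm]; exact h (φ i ∘ₗ π) m)

omit [SMulCommClass R S D] in
theorem apply_mem_radM_of_reduced [IsArtinianRing R] [Module.Finite R M] (hM : Reduced R M)
    (g : M →ₗ[R] D) (m : M) : g m ∈ radM R D := by
  let g' : M →ₗ[R] R := B.left.symm.toLinearMap ∘ₗ g
  suffices h : g' m ∈ Ring.jacobson R by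
    have := map_mem_radM_s4 B.left.toLinearMap h
    simpa [g'] using this
  refine mem_jacobson_of_isUnit_one_add_mul fun y => ?_
  let θ : R →ₗ[R] M := LinearMap.toSpanSingleton R M (y • m)
  let v : Module.End R M := θ ∘ₗ g'
  have hv : ∀ a, v a = g' a • y • m := fun a => rfl
  obtain ⟨n, hn⟩ := v.eventually_isCompl_ker_pow_range_pow.exists_forall_of_atTop
  have hc := hn (n + 1) n.le_succ
  -- the image of a power of `v` is a retract of `R`
  have hker : ∀ x : M, (v ^ (n + 1)) ((v ^ (n + 1)) x) = 0 → (v ^ (n + 1)) x = 0 := fun x hx =>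
    Submodule.disjoint_def.mp hc.disjoint _ hx (mem_range_self _ x)
  let N := range (v ^ (n + 1))
  let i : N →ₗ[R] R := g' ∘ₗ (v ^ n) ∘ₗ N.subtype
  let t : R →ₗ[R] N := (v ^ (n + 1)).rangeRestrict ∘ₗ θ
  have hti : ∀ x : N, ((t ∘ₗ i) x : M) = (v ^ (n + 1)) ((v ^ (n + 1)) x) := fun x => by
    change (v ^ (n + 1)) (v ((v ^ n) x)) = _
    rw [pow_succ' v n]
    rfl
  have hinj : Function.Injective (t ∘ₗ i) := by
    rw [injective_iff_map_eq_zero]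
    rintro ⟨_, z, rfl⟩ hz
    have h₀ := congrArg Subtype.val hz
    rw [hti] at h₀
    exact Subtype.ext (hker z (hker _ h₀))
  let T := LinearEquiv.ofBijective (t ∘ₗ i) (IsArtinian.bijective_of_injective_endomorphism _ hinj)
  have hP : Module.Projective R N :=
    Module.Projective.of_split i (T.symm.toLinearMap ∘ₗ t)
      (LinearMap.ext fun x => T.symm_apply_apply x)
  have hN : N = ⊥ := hM N _ hc.symm hP
  have hnil : IsNilpotent (y * g' m) := by
    refine ⟨n + 1 + 1, ?_⟩
    have key : ∀ j : ℕ, (v ^ j) (y • m) = (y * g' m) ^ j • y • m := fun j => by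
      induction j with
      | zero => simp
      | succ j ih =>
        rw [pow_succ', Module.End.mul_apply, ih, hv, map_smul, map_smul, pow_succ]
        simp [mul_assoc, smul_smul]
    have h₀ : (v ^ (n + 1)) (y • m) = 0 := by
      rw [← Submodule.mem_bot (R := R), ← hN]
      exact mem_range_self _ _
    rw [key] at h₀
    have := congrArg g' h₀
    simpa [pow_succ, mul_assoc] using this
  exact hnil.isUnit_one_add

variable {P₁ P₀ Z : Type u} [AddCommGroup P₁] [Module R P₁] [AddCommGroup P₀] [Module R P₀]
  [AddCommGroup Z] [Module S Z]

/-- Dualizing a minimal projective presentation of a reduced module gives a minimal projective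
presentation of the transpose. -/
theorem isMinPres_dual [IsArtinianRing R] (hM : Reduced R M) {f : P₁ →ₗ[R] P₀} {e : P₀ →ₗ[R] M}
    (h : IsMinPres R f e) {c : (P₁ →ₗ[R] D) →ₗ[S] Z} (hc : Function.Surjective c)
    (hck : ker c = range (dualMapInto S D f)) : IsMinPres S (dualMapInto S D f) c := by
  obtain ⟨⟨_, _, hes, hek⟩, hr, _, _, hk⟩ := h
  have : Module.Finite R M := Module.Finite.of_surjective e hes
  obtain ⟨hf₁, hp₁⟩ := B.finite_projective_dual (P := P₁)
  obtain ⟨hf₀, hp₀⟩ := B.finite_projective_dual (P := P₀)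
  refine ⟨⟨hp₁, hf₁, hc, ?_⟩, hck.symm, hp₀, hf₀, ?_⟩
  · rw [hck]
    rintro _ ⟨g, rfl⟩
    refine B.mem_radM_dual fun p => map_mem_radM_s4 g (hek ?_)
    rw [← hr]
    exact mem_range_self f p
  · intro g hg
    refine B.mem_radM_dual fun p => ?_
    have hge : ker e ≤ ker g := by
      rw [← hr]
      rintro _ ⟨x, rfl⟩
      exact LinearMap.congr_fun hg x
    obtain ⟨g', rfl⟩ := exists_comp_eq_of_ker_le hes hge
    exact B.apply_mem_radM_of_reduced hM g' (e p)

variable [SMulCommClass S R D]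

theorem reduced_transpose {f : P₁ →ₗ[R] P₀} {e : P₀ →ₗ[R] M}
    (h : IsMinPres R f e) {c : (P₁ →ₗ[R] D) →ₗ[S] Z} (hc : Function.Surjective c)
    (hck : ker c = range (dualMapInto S D f)) : Reduced S Z := by
  obtain ⟨⟨_, _, hes, hek⟩, hr, _, _, hk⟩ := h
  obtain ⟨hf₁, hp₁⟩ := B.finite_projective_dual (P := P₁)
  have : Module.Finite S Z := Module.Finite.of_surjective c hc
  refine B.symm.reduced_of_forall_mem_radM fun g z => ?_
  obtain ⟨φ, rfl⟩ := hc z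
  obtain ⟨p, hp⟩ := B.exists_eq_eval (g ∘ₗ c)
  have hfp : f p = 0 := B.eq_zero_of_forall_apply_eq_zero fun k => by
    have h₁ : c (dualMapInto S D f k) = 0 := by
      rw [← LinearMap.mem_ker, hck]; exact mem_range_self _ k
    have h₂ := hp (dualMapInto S D f k)
    rw [LinearMap.comp_apply, h₁, map_zero] at h₂
    exact h₂.symm
  have := hp φ
  rw [LinearMap.comp_apply] at this
  rw [this, ← B.mem_radM_iff]
  exact map_mem_radM_s4 φ (hk hfp)

/-- The evaluation isomorphism for finitely generated projective modules. -/
theorem exists_eval_equiv [Module.Finite R P] [Module.Projective R P] :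
    ∃ ε : P ≃ₗ[R] ((P →ₗ[R] D) →ₗ[S] D), ∀ p f, ε p f = f p := by
  let ev : P →ₗ[R] ((P →ₗ[R] D) →ₗ[S] D) :=
    { toFun := fun p => { toFun := fun f => f p, map_add' := fun _ _ => rfl,
                          map_smul' := fun _ _ => rfl }
      map_add' := fun p q => by ext f; simp
      map_smul' := fun r p => by ext f; simp }
  refine ⟨LinearEquiv.ofBijective ev ⟨?_, fun ψ => ?_⟩, fun p f => rfl⟩
  · rw [injective_iff_map_eq_zero]
    exact fun p hp => B.eq_zero_of_forall_apply_eq_zero fun f => LinearMap.congr_fun hp f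
  · obtain ⟨p, hp⟩ := B.exists_eq_eval ψ
    exact ⟨p, LinearMap.ext fun f => (hp f).symm⟩

theorem transpose_transpose [IsArtinianRing R] (hM : Reduced R M) (h : IsTranspose R S D M Z) :
    Module.Finite S Z ∧ Reduced S Z ∧ IsTranspose S R D Z M ∧ IsSyz2L S (M →ₗ[R] D) Z := by
  obtain ⟨P₁, P₀, f, e, hf, ⟨z⟩⟩ := h
  let c : (P₁ →ₗ[R] D) →ₗ[S] Z := z.symm.toLinearMap ∘ₗ (range (dualMapInto S D f)).mkQ
  have hc : Function.Surjective c := z.symm.surjective.comp (Submodule.mkQ_surjective _)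
  have hck : ker c = range (dualMapInto S D f) := by simp [c, ker_comp]
  have hd := B.isMinPres_dual hM hf hc hck
  obtain ⟨⟨_, _, hes, -⟩, hr, _, _, -⟩ := id hf
  have : Module.Finite S (P₁ →ₗ[R] D) := hd.1.2.1
  obtain ⟨ε₀, hε₀⟩ := B.exists_eval_equiv (P := P₀)
  obtain ⟨ε₁, hε₁⟩ := B.exists_eval_equiv (P := P₁)
  refine ⟨Module.Finite.of_surjective c hc, B.reduced_transpose hf hc hck, ?_, ?_⟩
  · refine ⟨ModuleCat.of S (P₀ →ₗ[R] D), ModuleCat.of S (P₁ →ₗ[R] D), dualMapInto S D f, c, hd, ⟨?_⟩⟩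
    have hε : ∀ x, ε₀ (f x) = dualMapInto R D (dualMapInto S D f) (ε₁ x) := fun x =>
      LinearMap.ext fun k => by simp [hε₀, hε₁]
    refine (e.quotKerEquivOfSurjective hes).symm ≪≫ₗ Submodule.Quotient.equiv _ _ ε₀ ?_
    rw [← hr]
    ext ψ
    simp only [Submodule.mem_map, mem_range]
    constructor
    · rintro ⟨_, ⟨x, rfl⟩, rfl⟩
      exact ⟨ε₁ x, (hε x).symm⟩
    · rintro ⟨φ, rfl⟩
      obtain ⟨x, rfl⟩ := ε₁.surjective φ
      exact ⟨_, ⟨x, rfl⟩, hε x⟩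
  · obtain ⟨κ⟩ := dual_equiv_ker (S := S) (D := D) hes hr
    obtain ⟨V, hV, Q, q, hq, ⟨w⟩⟩ := hd.isSyz2L
    exact ⟨V, hV, Q, q, hq, ⟨κ ≪≫ₗ w⟩⟩

end RegularBimodule

end Bimodule

/-- Proposition 2.4: `Tr` is a bijection between (iso classes of) reduced modules `M` with
`M` and `M^*` semi-Gorenstein-projective, and reduced ∞-torsionfree right modules `Z` with
`Ω²Z` semi-Gorenstein-projective; moreover `Ω²(Tr M) ≅ M^*` and `Tr Tr M ≅ M`. -/
theorem transpose_bijection_both_sgp (k : Type u) [CommRing k] [IsArtinianRing k]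
    (A : Type u) [Ring A] [Algebra k A] [Module.Finite k A] :
    (∀ M : ModuleCat.{u} A, BothSgpClass A (↥M) →
      ∀ Z : ModuleCat.{u} Aᵐᵒᵖ, IsTrL A (↥M) (↥Z) →
        (TfSyz2SgpClass A (↥Z) ∧
          ∀ W : ModuleCat.{u} Aᵐᵒᵖ, IsSyz2R A (↥W) (↥Z) →
            Nonempty ((↥W) ≃ₗ[Aᵐᵒᵖ] Dl A (↥M)))) ∧
    (∀ Z : ModuleCat.{u} Aᵐᵒᵖ, TfSyz2SgpClass A (↥Z) →
      ∀ M : ModuleCat.{u} A, IsTrR A (↥Z) (↥M) →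
        (BothSgpClass A (↥M) ∧
          ∀ W : ModuleCat.{u} Aᵐᵒᵖ, IsSyz2R A (↥W) (↥Z) →
            Nonempty ((Dl A (↥M)) ≃ₗ[Aᵐᵒᵖ] (↥W)))) ∧
    (∀ M : ModuleCat.{u} A, BothSgpClass A (↥M) →
      ∀ Z : ModuleCat.{u} Aᵐᵒᵖ, IsTrL A (↥M) (↥Z) →
        ∀ M' : ModuleCat.{u} A, IsTrR A (↥Z) (↥M') → Nonempty ((↥M') ≃ₗ[A] (↥M))) ∧
    (∀ Z : ModuleCat.{u} Aᵐᵒᵖ, TfSyz2SgpClass A (↥Z) →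
      ∀ M : ModuleCat.{u} A, IsTrR A (↥Z) (↥M) →
        ∀ Z' : ModuleCat.{u} Aᵐᵒᵖ, IsTrL A (↥M) (↥Z') → Nonempty ((↥Z') ≃ₗ[Aᵐᵒᵖ] (↥Z))) := by
  have : IsArtinianRing A := .of_finite k A
  have : IsArtinianRing Aᵐᵒᵖ := .of_finite k Aᵐᵒᵖ
  let B := RegularBimodule.ofRing A
  refine ⟨fun M ⟨_, hM, hsM, hsD⟩ Z hZ => ?_, fun Z ⟨_, hZ, ⟨M₀, hM₀, hs₀⟩, hsW⟩ M hM => ?_,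
    fun M ⟨_, hM, _, _⟩ Z hZ M' hM' => ?_, fun Z ⟨_, hZ, _, _⟩ M hM Z' hZ' => ?_⟩
  · obtain ⟨hfin, hred, htr, hsyz⟩ := B.transpose_transpose hM hZ
    have hW : ∀ W : ModuleCat.{u} Aᵐᵒᵖ, IsSyz2R A W Z → Nonempty (W ≃ₗ[Aᵐᵒᵖ] Dl A M) :=
      fun W h => IsSyz2L.unique h hsyz
    refine ⟨⟨hfin, hred, ⟨M, htr, hsM⟩, fun W h i hi => ?_⟩, hW⟩
    obtain ⟨w⟩ := hW W h
    exact extZero_congr w.symm (hsD i hi)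
  · obtain ⟨hfin, hred, htr, -⟩ := B.symm.transpose_transpose hZ hM
    obtain ⟨-, -, -, hsyz⟩ := B.transpose_transpose hred htr
    obtain ⟨μ⟩ := IsTranspose.unique (R := Aᵐᵒᵖ) (S := A) (D := A) hM₀ hM
    exact ⟨⟨hfin, hred, fun i hi => extZero_congr μ (hs₀ i hi),
      hsW (ModuleCat.of Aᵐᵒᵖ (Dl A M)) hsyz⟩, fun W h => IsSyz2L.unique hsyz h⟩
  · obtain ⟨-, -, htr, -⟩ := B.transpose_transpose hM hZ
    exact IsTranspose.unique (R := Aᵐᵒᵖ) (S := A) (D := A) hM' htr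
  · obtain ⟨-, -, htr, -⟩ := B.symm.transpose_transpose hZ hM
    exact IsTranspose.unique (R := A) (S := Aᵐᵒᵖ) (D := A) hZ' htr
end
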